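/- arXiv:alg-geom/9702018 — 12 statements merged into one kernel-verified Lean document; each statement's English description precedes it below -/
import Mathlib

section
/- Let α = (1/2, 1/3, 1/12, 1/12), the weight of the quasi-homogeneous polynomial f = x² + y³ + z¹² + w¹² (No.10 of Yonemura's table). Let α' = (α'₁, α'₂, α'₃, α'₄) ∈ ℚ⁴ with α'ᵢ > 0 for all i. Assume every monomial of f has α'-degree at least 1, i.e. 2α'₁ ≥ 1, 3α'₂ ≥ 1, 12α'₃ ≥ 1, 12α'₄ ≥ 1, and that there exists ν = (ν₁, ν₂, ν₃, ν₄) ∈ ℕ⁴ with ν₁α₁ + ν₂α₂ + ν₃α₃ + ν₄α₄ < 1 and ν₁α'₁ + ν₂α'₂ + ν₃α'₃ + ν₄α'₄ ≥ 1. Then α'₁ + α'₂ + α'₃ + α'₄ > 1. -/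
/-- Lemma 3.1 of Furuya, instantiated at Yonemura's polynomial (statement 0).
`a1' a2' a3' a4'` is the weight `α'`; the original weight is
`α = (1/2, 1/3, 1/12, 1/12)`. -/
theorem stmt_0 (a1' a2' a3' a4' : ℚ)
    (h1 : 0 < a1') (h2 : 0 < a2') (h3 : 0 < a3') (h4 : 0 < a4')
    (hm0 : 2*a1' ≥ 1)
    (hm1 : 3*a2' ≥ 1)
    (hm2 : 12*a3' ≥ 1)
    (hm3 : 12*a4' ≥ 1)
    (hnu : ∃ ν : Fin 4 → ℕ,
      (ν 0 : ℚ) * (1/2) + (ν 1 : ℚ) * (1/3) + (ν 2 : ℚ) * (1/12) + (ν 3 : ℚ) * (1/12) < 1 ∧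
      (ν 0 : ℚ) * a1' + (ν 1 : ℚ) * a2' + (ν 2 : ℚ) * a3' + (ν 3 : ℚ) * a4' ≥ 1) :
    a1' + a2' + a3' + a4' > 1 := by
  obtain ⟨ν, hlt, hge⟩ := hnu
  by_contra! hle
  -- The lower bounds on the `aᵢ'` already sum to `1`, so each of them is attained.
  obtain rfl : a1' = 1/2 := by linarith
  obtain rfl : a2' = 1/3 := by linarith
  obtain rfl : a3' = 1/12 := by linarith
  obtain rfl : a4' = 1/12 := by linarith
  exact hlt.not_ge hge
end

section
/- Let α = (1/2, 1/3, 1/8, 1/24), the weight of the quasi-homogeneous polynomial f = x² + y³ + z⁸ + w²⁴ (No.13 of Yonemura's table). Let α' = (α'₁, α'₂, α'₃, α'₄) ∈ ℚ⁴ with α'ᵢ > 0 for all i. Assume 2α'₁ ≥ 1, 3α'₂ ≥ 1, 8α'₃ ≥ 1, 24α'₄ ≥ 1, and that there exists ν = (ν₁, ν₂, ν₃, ν₄) ∈ ℕ⁴ with ν₁α₁ + ν₂α₂ + ν₃α₃ + ν₄α₄ < 1 and ν₁α'₁ + ν₂α'₂ + ν₃α'₃ + ν₄α'₄ ≥ 1.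 Then α'₁ + α'₂ + α'₃ + α'₄ > 1. -/
/-- Lemma 3.1 of Furuya, instantiated at Yonemura's polynomial (statement 3).
`a1' a2' a3' a4'` is the weight `α'`; the original weight is
`α = (1/2, 1/3, 1/8, 1/24)`. -/
theorem stmt_3 (a1' a2' a3' a4' : ℚ)
    (h1 : 0 < a1') (h2 : 0 < a2') (h3 : 0 < a3') (h4 : 0 < a4')
    (hm0 : 2*a1' ≥ 1)
    (hm1 : 3*a2' ≥ 1)
    (hm2 : 8*a3' ≥ 1)
    (hm3 : 24*a4' ≥ 1)
    (hnu : ∃ ν : Fin 4 → ℕ,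
      (ν 0 : ℚ) * (1/2) + (ν 1 : ℚ) * (1/3) + (ν 2 : ℚ) * (1/8) + (ν 3 : ℚ) * (1/24) < 1 ∧
      (ν 0 : ℚ) * a1' + (ν 1 : ℚ) * a2' + (ν 2 : ℚ) * a3' + (ν 3 : ℚ) * a4' ≥ 1) :
    a1' + a2' + a3' + a4' > 1 := by
  obtain ⟨ν, hlt, hge⟩ := hnu
  by_contra! hsum
  -- The original weights sum to `1` and bound `α'` from below, so the two weights agree.
  obtain rfl : a1' = 1/2 := by linarith
  obtain rfl : a2' = 1/3 := by linarith
  obtain rfl : a3' = 1/8 := by linarith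
  obtain rfl : a4' = 1/24 := by linarith
  exact hge.not_gt hlt
end

section
/- Let α = (1/2, 1/3, 1/11, 5/66), the weight of the quasi-homogeneous polynomial f = x² + y³ + z¹¹ + z w¹² (No.46 of Yonemura's table). Let α' = (α'₁, α'₂, α'₃, α'₄) ∈ ℚ⁴ with α'ᵢ > 0 for all i. Assume every monomial of f has α'-degree at least 1, i.e. 2α'₁ ≥ 1, 3α'₂ ≥ 1, 11α'₃ ≥ 1, α'₃ + 12α'₄ ≥ 1, and that there exists ν = (ν₁, ν₂, ν₃, ν₄) ∈ ℕ⁴ with ν₁α₁ + ν₂α₂ + ν₃α₃ + ν₄α₄ < 1 and ν₁α'₁ + ν₂α'₂ + ν₃α'₃ + ν₄α'₄ ≥ 1. Then α'₁ + α'₂ + α'₃ + α'₄ > 1. -/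
/-- Lemma 3.1 of Furuya, instantiated at Yonemura's polynomial (statement 5).
`a1' a2' a3' a4'` is the weight `α'`; the original weight is
`α = (1/2, 1/3, 1/11, 5/66)`. -/
theorem stmt_5 (a1' a2' a3' a4' : ℚ)
    (h1 : 0 < a1') (h2 : 0 < a2') (h3 : 0 < a3') (h4 : 0 < a4')
    (hm0 : 2*a1' ≥ 1)
    (hm1 : 3*a2' ≥ 1)
    (hm2 : 11*a3' ≥ 1)
    (hm3 : a3' + 12*a4' ≥ 1)
    (hnu : ∃ ν : Fin 4 → ℕ,
      (ν 0 : ℚ) * (1/2) + (ν 1 : ℚ) * (1/3) + (ν 2 : ℚ) * (1/11) + (ν 3 : ℚ) * (5/66) < 1 ∧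
      (ν 0 : ℚ) * a1' + (ν 1 : ℚ) * a2' + (ν 2 : ℚ) * a3' + (ν 3 : ℚ) * a4' ≥ 1) :
    a1' + a2' + a3' + a4' > 1 := by
  obtain ⟨ν, hlt, hge⟩ := hnu
  by_contra! hsum
  have e1 : a1' = 1/2 := by linarith
  have e2 : a2' = 1/3 := by linarith
  have e3 : a3' = 1/11 := by linarith
  have e4 : a4' = 5/66 := by linarith
  rw [e1, e2, e3, e4] at hge
  exact absurd hlt (not_lt.mpr hge)
end

section
/- Let α = (1/2, 1/3, 2/21, 1/14), the weight of the quasi-homogeneous polynomial f = x² + y³ + y z⁷ + z⁹ w² + w¹⁴ (No.47 of Yonemura's table). Let α' = (α'₁, α'₂, α'₃, α'₄) ∈ ℚ⁴ with α'ᵢ > 0 for all i. Assume every monomial of f has α'-degree at least 1, i.e. 2α'₁ ≥ 1, 3α'₂ ≥ 1, α'₂ + 7α'₃ ≥ 1, 9α'₃ + 2α'₄ ≥ 1, 14α'₄ ≥ 1, and that there exists ν = (ν₁, ν₂, ν₃, ν₄) ∈ ℕ⁴ with ν₁α₁ + ν₂α₂ + ν₃α₃ + ν₄α₄ < 1 and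 ν₁α'₁ + ν₂α'₂ + ν₃α'₃ + ν₄α'₄ ≥ 1. Then α'₁ + α'₂ + α'₃ + α'₄ > 1. -/
/-- Lemma 3.1 of Furuya, instantiated at Yonemura's polynomial (statement 6).
`a1' a2' a3' a4'` is the weight `α'`; the original weight is
`α = (1/2, 1/3, 2/21, 1/14)`. -/
theorem stmt_6 (a1' a2' a3' a4' : ℚ)
    (h1 : 0 < a1') (h2 : 0 < a2') (h3 : 0 < a3') (h4 : 0 < a4')
    (hm0 : 2*a1' ≥ 1)
    (hm1 : 3*a2' ≥ 1)
    (hm2 : a2' + 7*a3' ≥ 1)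
    (hm3 : 9*a3' + 2*a4' ≥ 1)
    (hm4 : 14*a4' ≥ 1)
    (hnu : ∃ ν : Fin 4 → ℕ,
      (ν 0 : ℚ) * (1/2) + (ν 1 : ℚ) * (1/3) + (ν 2 : ℚ) * (2/21) + (ν 3 : ℚ) * (1/14) < 1 ∧
      (ν 0 : ℚ) * a1' + (ν 1 : ℚ) * a2' + (ν 2 : ℚ) * a3' + (ν 3 : ℚ) * a4' ≥ 1) :
    a1' + a2' + a3' + a4' > 1 := by
  obtain ⟨ν, hlt, hge⟩ := hnu
  by_contra! hsum
  -- The weight sum of `α` is exactly `1`, which forces `α' = α`.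
  obtain rfl : a1' = 1/2 := by linarith
  obtain rfl : a2' = 1/3 := by linarith
  obtain rfl : a3' = 2/21 := by linarith
  obtain rfl : a4' = 1/14 := by linarith
  linarith
end

section
/- Let α = (1/2, 1/3, 5/48, 1/16), the weight of the quasi-homogeneous polynomial f = x² + y³ + z⁹ w + w¹⁶ (No.48 of Yonemura's table). Let α' = (α'₁, α'₂, α'₃, α'₄) ∈ ℚ⁴ with α'ᵢ > 0 for all i. Assume every monomial of f has α'-degree at least 1, i.e. 2α'₁ ≥ 1, 3α'₂ ≥ 1, 9α'₃ + α'₄ ≥ 1, 16α'₄ ≥ 1, and that there exists ν = (ν₁, ν₂, ν₃, ν₄) ∈ ℕ⁴ with ν₁α₁ + ν₂α₂ + ν₃α₃ + ν₄α₄ < 1 and ν₁α'₁ + ν₂α'₂ + ν₃α'₃ + ν₄α'₄ ≥ 1. Then α'₁ + α'₂ + α'₃ + α'₄ > 1. -/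
/-- Lemma 3.1 of Furuya, instantiated at Yonemura's polynomial (statement 7).
`a1' a2' a3' a4'` is the weight `α'`; the original weight is
`α = (1/2, 1/3, 5/48, 1/16)`. -/
theorem stmt_7 (a1' a2' a3' a4' : ℚ)
    (h1 : 0 < a1') (h2 : 0 < a2') (h3 : 0 < a3') (h4 : 0 < a4')
    (hm0 : 2*a1' ≥ 1)
    (hm1 : 3*a2' ≥ 1)
    (hm2 : 9*a3' + a4' ≥ 1)
    (hm3 : 16*a4' ≥ 1)
    (hnu : ∃ ν : Fin 4 → ℕ,
      (ν 0 : ℚ) * (1/2) + (ν 1 : ℚ) * (1/3) + (ν 2 : ℚ) * (5/48) + (ν 3 : ℚ) * (1/16) < 1 ∧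
      (ν 0 : ℚ) * a1' + (ν 1 : ℚ) * a2' + (ν 2 : ℚ) * a3' + (ν 3 : ℚ) * a4' ≥ 1) :
    a1' + a2' + a3' + a4' > 1 := by
  obtain ⟨ν, hα, hα'⟩ := hnu
  by_contra! hsum
  -- The constraints force `α' = α`, so the two degrees of `ν` agree.
  obtain rfl : a1' = 1/2 := by linarith
  obtain rfl : a2' = 1/3 := by linarith
  obtain rfl : a4' = 1/16 := by linarith
  obtain rfl : a3' = 5/48 := by linarith
  exact hα'.not_gt hα
end

section
/- Let α = (1/2, 1/3, 5/42, 1/21), the weight of the quasi-homogeneous polynomial f = x² + y³ + z⁸ w + w²¹ (No.49 of Yonemura's table). Let α' = (α'₁, α'₂, α'₃, α'₄) ∈ ℚ⁴ with α'ᵢ > 0 for all i. Assume every monomial of f has α'-degree at least 1, i.e. 2α'₁ ≥ 1, 3α'₂ ≥ 1, 8α'₃ + α'₄ ≥ 1, 21α'₄ ≥ 1, and that there exists ν = (ν₁, ν₂, ν₃, ν₄) ∈ ℕ⁴ with ν₁α₁ + ν₂α₂ + ν₃α₃ + ν₄α₄ < 1 and ν₁α'₁ + ν₂α'₂ + ν₃α'₃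 + ν₄α'₄ ≥ 1. Then α'₁ + α'₂ + α'₃ + α'₄ > 1. -/
/-- Lemma 3.1 of Furuya, instantiated at Yonemura's polynomial (statement 8).
`a1' a2' a3' a4'` is the weight `α'`; the original weight is
`α = (1/2, 1/3, 5/42, 1/21)`. -/
theorem stmt_8 (a1' a2' a3' a4' : ℚ)
    (h1 : 0 < a1') (h2 : 0 < a2') (h3 : 0 < a3') (h4 : 0 < a4')
    (hm0 : 2*a1' ≥ 1)
    (hm1 : 3*a2' ≥ 1)
    (hm2 : 8*a3' + a4' ≥ 1)
    (hm3 : 21*a4' ≥ 1)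
    (hnu : ∃ ν : Fin 4 → ℕ,
      (ν 0 : ℚ) * (1/2) + (ν 1 : ℚ) * (1/3) + (ν 2 : ℚ) * (5/42) + (ν 3 : ℚ) * (1/21) < 1 ∧
      (ν 0 : ℚ) * a1' + (ν 1 : ℚ) * a2' + (ν 2 : ℚ) * a3' + (ν 3 : ℚ) * a4' ≥ 1) :
    a1' + a2' + a3' + a4' > 1 := by
  obtain ⟨ν, hlt, hge⟩ := hnu
  by_contra! hsum
  have e1 : a1' = 1/2 := by linarith
  have e2 : a2' = 1/3 := by linarith
  have e4 : a4' = 1/21 := by linarith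
  have e3 : a3' = 5/42 := by linarith
  subst e1 e2 e3 e4
  exact absurd hlt (not_lt.mpr hge)
end

section
/- Let α = (1/2, 1/3, 2/15, 1/30), the weight of the quasi-homogeneous polynomial f = x² + y³ + y z⁵ + z⁷ w² + w³⁰ (No.50 of Yonemura's table). Let α' = (α'₁, α'₂, α'₃, α'₄) ∈ ℚ⁴ with α'ᵢ > 0 for all i. Assume every monomial of f has α'-degree at least 1, i.e. 2α'₁ ≥ 1, 3α'₂ ≥ 1, α'₂ + 5α'₃ ≥ 1, 7α'₃ + 2α'₄ ≥ 1, 30α'₄ ≥ 1, and that there exists ν = (ν₁, ν₂, ν₃, ν₄) ∈ ℕ⁴ with ν₁α₁ + ν₂α₂ + ν₃α₃ + ν₄α₄ < 1 and ν₁α'₁ + ν₂α'₂ + ν₃α'₃ + ν₄α'₄ ≥ 1. Then α'₁ + α'₂ + α'₃ + α'₄ > 1. -/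
/-- Lemma 3.1 of Furuya, instantiated at Yonemura's polynomial (statement 9).
`a1' a2' a3' a4'` is the weight `α'`; the original weight is
`α = (1/2, 1/3, 2/15, 1/30)`. -/
theorem stmt_9 (a1' a2' a3' a4' : ℚ)
    (h1 : 0 < a1') (h2 : 0 < a2') (h3 : 0 < a3') (h4 : 0 < a4')
    (hm0 : 2*a1' ≥ 1)
    (hm1 : 3*a2' ≥ 1)
    (hm2 : a2' + 5*a3' ≥ 1)
    (hm3 : 7*a3' + 2*a4' ≥ 1)
    (hm4 : 30*a4' ≥ 1)
    (hnu : ∃ ν : Fin 4 → ℕ,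
      (ν 0 : ℚ) * (1/2) + (ν 1 : ℚ) * (1/3) + (ν 2 : ℚ) * (2/15) + (ν 3 : ℚ) * (1/30) < 1 ∧
      (ν 0 : ℚ) * a1' + (ν 1 : ℚ) * a2' + (ν 2 : ℚ) * a3' + (ν 3 : ℚ) * a4' ≥ 1) :
    a1' + a2' + a3' + a4' > 1 := by
  obtain ⟨ν, hlt, hge⟩ := hnu
  by_contra! hsum
  -- Five times the weight sum is a positive combination of the monomial degrees, bounded below by 5,
  -- with equality only at the original weight.
  have e1 : a1' = 1 / 2 := by linarith
  have e2 : a2' = 1 / 3 := by linarith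
  have e3 : a3' = 2 / 15 := by linarith
  have e4 : a4' = 1 / 30 := by linarith
  subst e1 e2 e3 e4
  exact hlt.not_ge hge
end

section
/- Let α = (1/2, 1/3, 5/36, 1/36), the weight of the quasi-homogeneous polynomial f = x² + y³ + z⁷ w + w³⁶ (No.51 of Yonemura's table). Let α' = (α'₁, α'₂, α'₃, α'₄) ∈ ℚ⁴ with α'ᵢ > 0 for all i. Assume every monomial of f has α'-degree at least 1, i.e. 2α'₁ ≥ 1, 3α'₂ ≥ 1, 7α'₃ + α'₄ ≥ 1, 36α'₄ ≥ 1, and that there exists ν = (ν₁, ν₂, ν₃, ν₄) ∈ ℕ⁴ with ν₁α₁ + ν₂α₂ + ν₃α₃ + ν₄α₄ < 1 and ν₁α'₁ + ν₂α'₂ + ν₃α'₃ + ν₄α'₄ ≥ 1. Then α'₁ + α'₂ + α'₃ + α'₄ > 1. -/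
/-- Lemma 3.1 of Furuya, instantiated at Yonemura's polynomial (statement 10).
`a1' a2' a3' a4'` is the weight `α'`; the original weight is
`α = (1/2, 1/3, 5/36, 1/36)`. -/
theorem stmt_10 (a1' a2' a3' a4' : ℚ)
    (h1 : 0 < a1') (h2 : 0 < a2') (h3 : 0 < a3') (h4 : 0 < a4')
    (hm0 : 2*a1' ≥ 1)
    (hm1 : 3*a2' ≥ 1)
    (hm2 : 7*a3' + a4' ≥ 1)
    (hm3 : 36*a4' ≥ 1)
    (hnu : ∃ ν : Fin 4 → ℕ,
      (ν 0 : ℚ) * (1/2) + (ν 1 : ℚ) * (1/3) + (ν 2 : ℚ) * (5/36) + (ν 3 : ℚ) * (1/36) < 1 ∧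
      (ν 0 : ℚ) * a1' + (ν 1 : ℚ) * a2' + (ν 2 : ℚ) * a3' + (ν 3 : ℚ) * a4' ≥ 1) :
    a1' + a2' + a3' + a4' > 1 := by
  obtain ⟨ν, hlt, hge⟩ := hnu
  by_contra! hsum
  -- The constraints on `f` together with total weight at most `1` force `α' = α`.
  obtain rfl : a1' = 1/2 := by linarith
  obtain rfl : a2' = 1/3 := by linarith
  obtain rfl : a3' = 5/36 := by linarith
  obtain rfl : a4' = 1/36 := by linarith
  exact absurd hlt (not_lt.mpr hge)
end

section
/- Let α = (1/2, 1/3, 5/54, 2/27), the weight of the quasi-homogeneous polynomial f = x² + y³ + y w⁹ + z¹⁰ w + z² w¹¹ (No.83 of Yonemura's table). Let α' = (α'₁, α'₂, α'₃, α'₄) ∈ ℚ⁴ with α'ᵢ > 0 for all i. Assume every monomial of f has α'-degree at least 1, i.e. 2α'₁ ≥ 1, 3α'₂ ≥ 1, α'₂ + 9α'₄ ≥ 1, 10α'₃ + α'₄ ≥ 1, 2α'₃ + 11α'₄ ≥ 1, and that there exists ν = (ν₁, ν₂, ν₃, ν₄) ∈ ℕ⁴ with ν₁α₁ + ν₂α₂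 + ν₃α₃ + ν₄α₄ < 1 and ν₁α'₁ + ν₂α'₂ + ν₃α'₃ + ν₄α'₄ ≥ 1. Then α'₁ + α'₂ + α'₃ + α'₄ > 1. -/
/-- Lemma 3.1 of Furuya, instantiated at Yonemura's polynomial (statement 11).
`a1' a2' a3' a4'` is the weight `α'`; the original weight is
`α = (1/2, 1/3, 5/54, 2/27)`. -/
theorem stmt_11 (a1' a2' a3' a4' : ℚ)
    (h1 : 0 < a1') (h2 : 0 < a2') (h3 : 0 < a3') (h4 : 0 < a4')
    (hm0 : 2*a1' ≥ 1)
    (hm1 : 3*a2' ≥ 1)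
    (hm2 : a2' + 9*a4' ≥ 1)
    (hm3 : 10*a3' + a4' ≥ 1)
    (hm4 : 2*a3' + 11*a4' ≥ 1)
    (hnu : ∃ ν : Fin 4 → ℕ,
      (ν 0 : ℚ) * (1/2) + (ν 1 : ℚ) * (1/3) + (ν 2 : ℚ) * (5/54) + (ν 3 : ℚ) * (2/27) < 1 ∧
      (ν 0 : ℚ) * a1' + (ν 1 : ℚ) * a2' + (ν 2 : ℚ) * a3' + (ν 3 : ℚ) * a4' ≥ 1) :
    a1' + a2' + a3' + a4' > 1 := by
  obtain ⟨ν, hlt, hge⟩ := hnu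
  by_contra! hsum
  have e1 : a1' = 1/2 := by linarith
  have e2 : a2' = 1/3 := by linarith
  have e3 : a3' = 5/54 := by linarith
  have e4 : a4' = 2/27 := by linarith
  subst e1 e2 e3 e4
  exact absurd hlt (not_lt.mpr hge)
end

section
/- Let α = (α₁, α₂, α₃, α₄) and α' = (α'₁, α'₂, α'₃, α'₄) be vectors of positive rational numbers, and let I, J, K, L ≥ 2 be integers. Assume Iα₁ = 1, Jα₂ = 1, Kα₃ + α₄ = 1, α₃ + Lα₄ = 1, that Iα'₁ ≥ 1, Jα'₂ ≥ 1, Kα'₃ + α'₄ ≥ 1, α'₃ + Lα'₄ ≥ 1, and that α_i < α'_i for some index i. Then α₁ + α₂ + α₃ + α₄ < α'₁ + α'₂ + α'₃ + α'₄. -/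
/-- If `k, l > 1` and both `k * x + y` and `x + l * y` are nonnegative, then `x + y` is positive
unless `x` and `y` both vanish. -/
theorem add_pos_or_eq_zero_of_loop_nonneg {k l x y : ℚ} (hk : 1 < k) (hl : 1 < l)
    (hx : 0 ≤ k * x + y) (hy : 0 ≤ x + l * y) : 0 < x + y ∨ (x = 0 ∧ y = 0) := by
  rcases lt_trichotomy x 0 with h | h | h
  · left
    nlinarith [mul_pos (sub_pos.2 hk) (neg_pos.2 h)]
  · subst h
    rcases (show 0 ≤ y by linarith).eq_or_lt with h | h
    · exact Or.inr ⟨rfl, h.symm⟩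
    · left
      linarith
  · left
    rcases le_or_gt 0 y with h' | h'
    · linarith
    · nlinarith [mul_pos (sub_pos.2 hl) (neg_pos.2 h')]

/-- A case in the proof of Lemma 3.1 of Furuya's paper (statement 17).
`a1 a2 a3 a4` is the weight `α` and `b1 b2 b3 b4` is the weight `α'`. -/
theorem stmt_17 (a1 a2 a3 a4 b1 b2 b3 b4 : ℚ)
    (ha1 : 0 < a1) (ha2 : 0 < a2) (ha3 : 0 < a3) (ha4 : 0 < a4)
    (hb1 : 0 < b1) (hb2 : 0 < b2) (hb3 : 0 < b3) (hb4 : 0 < b4)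
    (I J K L : ℤ) (hI : 2 ≤ I) (hJ : 2 ≤ J) (hK : 2 ≤ K) (hL : 2 ≤ L)
    (he1 : (I : ℚ) * a1 = 1)
    (he2 : (J : ℚ) * a2 = 1)
    (he3 : (K : ℚ) * a3 + a4 = 1)
    (he4 : a3 + (L : ℚ) * a4 = 1)
    (hi1 : (I : ℚ) * b1 ≥ 1)
    (hi2 : (J : ℚ) * b2 ≥ 1)
    (hi3 : (K : ℚ) * b3 + b4 ≥ 1)
    (hi4 : b3 + (L : ℚ) * b4 ≥ 1)
    (hex : a1 < b1 ∨ a2 < b2 ∨ a3 < b3 ∨ a4 < b4) :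
    a1 + a2 + a3 + a4 < b1 + b2 + b3 + b4 := by
  have hI' : (2 : ℚ) ≤ I := by exact_mod_cast hI
  have hJ' : (2 : ℚ) ≤ J := by exact_mod_cast hJ
  have hK' : (2 : ℚ) ≤ K := by exact_mod_cast hK
  have hL' : (2 : ℚ) ≤ L := by exact_mod_cast hL
  have h1 : a1 ≤ b1 := le_of_mul_le_mul_left (by linarith) (by linarith : (0 : ℚ) < I)
  have h2 : a2 ≤ b2 := le_of_mul_le_mul_left (by linarith) (by linarith : (0 : ℚ) < J)
  rcases add_pos_or_eq_zero_of_loop_nonneg (x := b3 - a3) (y := b4 - a4)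
    (by linarith : (1 : ℚ) < K) (by linarith : (1 : ℚ) < L) (by linarith) (by linarith)
    with h | ⟨hx, hy⟩
  · linarith
  · rcases hex with h | h | h | h <;> linarith
end

section
/- Let α = (α₁, α₂, α₃, α₄) and α' = (α'₁, α'₂, α'₃, α'₄) be vectors of positive rational numbers, and let I, J, K, L ≥ 2 be integers. Assume Iα₁ = 1, Jα₂ = 1, α₂ + Kα₃ = 1, α₁ + Lα₄ = 1, that Iα'₁ ≥ 1, Jα'₂ ≥ 1, α'₂ + Kα'₃ ≥ 1, α'₁ + Lα'₄ ≥ 1, and that α_i < α'_i for some index i. Then α₁ + α₂ + α₃ + α₄ < α'₁ + α'₂ + α'₃ + α'₄. -/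
/-- If `0 ≤ x` and `0 ≤ x + n * y` with `n > 1`, then `x + y` is positive unless `x = y = 0`. -/
lemma add_pos_or_eq_zero_of_add_mul_nonneg {x y n : ℚ} (hx : 0 ≤ x) (hn : 1 < n)
    (h : 0 ≤ x + n * y) : 0 < x + y ∨ x = 0 ∧ y = 0 := by
  rcases lt_trichotomy y 0 with hy | rfl | hy
  · left
    nlinarith
  · rcases hx.eq_or_lt with rfl | hx
    · exact Or.inr ⟨rfl, rfl⟩
    · left
      linarith
  · left
    linarith

/-- A case in the proof of Lemma 3.1 of Furuya's paper (statement 18).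
`a1 a2 a3 a4` is the weight `α` and `b1 b2 b3 b4` is the weight `α'`. -/
theorem stmt_18 (a1 a2 a3 a4 b1 b2 b3 b4 : ℚ)
    (ha1 : 0 < a1) (ha2 : 0 < a2) (ha3 : 0 < a3) (ha4 : 0 < a4)
    (hb1 : 0 < b1) (hb2 : 0 < b2) (hb3 : 0 < b3) (hb4 : 0 < b4)
    (I J K L : ℤ) (hI : 2 ≤ I) (hJ : 2 ≤ J) (hK : 2 ≤ K) (hL : 2 ≤ L)
    (he1 : (I : ℚ) * a1 = 1)
    (he2 : (J : ℚ) * a2 = 1)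
    (he3 : a2 + (K : ℚ) * a3 = 1)
    (he4 : a1 + (L : ℚ) * a4 = 1)
    (hi1 : (I : ℚ) * b1 ≥ 1)
    (hi2 : (J : ℚ) * b2 ≥ 1)
    (hi3 : b2 + (K : ℚ) * b3 ≥ 1)
    (hi4 : b1 + (L : ℚ) * b4 ≥ 1)
    (hex : a1 < b1 ∨ a2 < b2 ∨ a3 < b3 ∨ a4 < b4) :
    a1 + a2 + a3 + a4 < b1 + b2 + b3 + b4 := by
  have hI' : (0 : ℚ) < I := by exact_mod_cast (by lia : 0 < I)
  have hJ' : (0 : ℚ) < J := by exact_mod_cast (by lia : 0 < J)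
  have hK' : (1 : ℚ) < K := by exact_mod_cast (by lia : 1 < K)
  have hL' : (1 : ℚ) < L := by exact_mod_cast (by lia : 1 < L)
  have h1 : a1 ≤ b1 := le_of_mul_le_mul_left (he1.trans_le hi1) hI'
  have h2 : a2 ≤ b2 := le_of_mul_le_mul_left (he2.trans_le hi2) hJ'
  have h14 := add_pos_or_eq_zero_of_add_mul_nonneg (y := b4 - a4) (sub_nonneg.2 h1) hL'
    (by linarith)
  have h23 := add_pos_or_eq_zero_of_add_mul_nonneg (y := b3 - a3) (sub_nonneg.2 h2) hK'
    (by linarith)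
  rcases h14 with h14 | ⟨h1, h4⟩ <;> rcases h23 with h23 | ⟨h2, h3⟩
  · linarith
  · linarith
  · linarith
  · rcases hex with h | h | h | h <;> linarith
end

section
/- Let α = (α₁, α₂, α₃, α₄) and α' = (α'₁, α'₂, α'₃, α'₄) be vectors of positive rational numbers, and let I, J, K, L ≥ 2 be integers. Assume Iα₁ + α₂ = 1, α₁ + Jα₂ = 1, Kα₃ + α₄ = 1, α₃ + Lα₄ = 1, that Iα'₁ + α'₂ ≥ 1, α'₁ + Jα'₂ ≥ 1, Kα'₃ + α'₄ ≥ 1, α'₃ + Lα'₄ ≥ 1, and that α_i < α'_i for some index i. Then α₁ + α₂ + α₃ + α₄ < α'₁ + α'₂ + α'₃ + α'₄. -/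
theorem add_pos_of_pos_of_add_mul_nonneg {x y q : ℚ} (hq : 2 ≤ q)
    (h : 0 ≤ x + q * y) (hx : 0 < x) : 0 < x + y := by
  rcases le_or_gt 0 y with hy | hy
  · linarith
  · nlinarith

theorem add_nonneg_of_mul_add_nonneg {x y p q : ℚ} (hp : 2 ≤ p) (hq : 2 ≤ q)
    (h₁ : 0 ≤ p * x + y) (h₂ : 0 ≤ x + q * y) : 0 ≤ x + y := by
  rcases le_or_gt x 0 with hx | hx
  · nlinarith
  · exact (add_pos_of_pos_of_add_mul_nonneg hq h₂ hx).le

/-- A case in the proof of Lemma 3.1 of Furuya's paper (statement 19).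
`a1 a2 a3 a4` is the weight `α` and `b1 b2 b3 b4` is the weight `α'`. -/
theorem stmt_19 (a1 a2 a3 a4 b1 b2 b3 b4 : ℚ)
    (ha1 : 0 < a1) (ha2 : 0 < a2) (ha3 : 0 < a3) (ha4 : 0 < a4)
    (hb1 : 0 < b1) (hb2 : 0 < b2) (hb3 : 0 < b3) (hb4 : 0 < b4)
    (I J K L : ℤ) (hI : 2 ≤ I) (hJ : 2 ≤ J) (hK : 2 ≤ K) (hL : 2 ≤ L)
    (he1 : (I : ℚ) * a1 + a2 = 1)
    (he2 : a1 + (J : ℚ) * a2 = 1)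
    (he3 : (K : ℚ) * a3 + a4 = 1)
    (he4 : a3 + (L : ℚ) * a4 = 1)
    (hi1 : (I : ℚ) * b1 + b2 ≥ 1)
    (hi2 : b1 + (J : ℚ) * b2 ≥ 1)
    (hi3 : (K : ℚ) * b3 + b4 ≥ 1)
    (hi4 : b3 + (L : ℚ) * b4 ≥ 1)
    (hex : a1 < b1 ∨ a2 < b2 ∨ a3 < b3 ∨ a4 < b4) :
    a1 + a2 + a3 + a4 < b1 + b2 + b3 + b4 := by
  have hI' : (2 : ℚ) ≤ I := by exact_mod_cast hI
  have hJ' : (2 : ℚ) ≤ J := by exact_mod_cast hJ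
  have hK' : (2 : ℚ) ≤ K := by exact_mod_cast hK
  have hL' : (2 : ℚ) ≤ L := by exact_mod_cast hL
  have d1 : 0 ≤ (I : ℚ) * (b1 - a1) + (b2 - a2) := by linarith
  have d2 : 0 ≤ (b1 - a1) + (J : ℚ) * (b2 - a2) := by linarith
  have d3 : 0 ≤ (K : ℚ) * (b3 - a3) + (b4 - a4) := by linarith
  have d4 : 0 ≤ (b3 - a3) + (L : ℚ) * (b4 - a4) := by linarith
  have s12 := add_nonneg_of_mul_add_nonneg hI' hJ' d1 d2
  have s34 := add_nonneg_of_mul_add_nonneg hK' hL' d3 d4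
  rw [add_comm] at d1 d3
  rcases hex with h | h | h | h
  · linarith [add_pos_of_pos_of_add_mul_nonneg hJ' d2 (sub_pos.2 h)]
  · linarith [add_pos_of_pos_of_add_mul_nonneg hI' d1 (sub_pos.2 h)]
  · linarith [add_pos_of_pos_of_add_mul_nonneg hL' d4 (sub_pos.2 h)]
  · linarith [add_pos_of_pos_of_add_mul_nonneg hK' d3 (sub_pos.2 h)]
end
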